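/- For a > 0 and s ∈ ℝ, let α̂_{a,s} be the linear automorphism of ℝ² given by α̂_{a,s}(ξ₁,ξ₂) = (a·ξ₁, s·√a·ξ₁ + √a·ξ₂), and let B_∞(0,ε) = {ξ ∈ ℝ² : max{|ξ₁|,|ξ₂|} < ε}. Then for every ε > 0, ♯(ℤ² ∩ α̂_{a,s} B_∞(0,ε)) ≤ (⌊2εa⌋ + 1)(⌊2ε√a⌋ + 1); moreover, for every ε ∈ (0, 1/2): if a < 1 then ♯(ℤ² ∩ α̂_{a,s} B_∞(0,ε)) = 1, while if a ≥ 1 then ♯(ℤ² ∩ α̂_{a,s} B_∞(0,ε)) ≤ 1 + 4ε(ε+1)·a^{3/2}. In particular the shearlet family {α̂_{a,s}} has Property X with δ(a,s) = a^{3/2}. -/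

import Mathlib

open Set

/-- The dual shearlet automorphism `αd_{a,s}(ξ₁,ξ₂) = (a ξ₁, s √a ξ₁ + √a ξ₂)` of `ℝ²`. -/
noncomputable def shearAut (a s : ℝ) : ℝ × ℝ → ℝ × ℝ :=
  fun ξ => (a * ξ.1, s * Real.sqrt a * ξ.1 + Real.sqrt a * ξ.2)

/-- The `ℓ^∞` ball `B_∞(0,ε) = {ξ ∈ ℝ² : max(|ξ₁|,|ξ₂|) < ε}`. -/
def ballInf (ε : ℝ) : Set (ℝ × ℝ) := {ξ | |ξ.1| < ε ∧ |ξ.2| < ε}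

/-- The integer lattice `ℤ² ⊆ ℝ²`. -/
def intLattice : Set (ℝ × ℝ) := {p | ∃ m n : ℤ, p = ((m : ℝ), (n : ℝ))}

/-- An integer in the open interval `(x, x + L)` is one of the `⌊L⌋₊ + 1` integers following `⌊x⌋`. -/
theorem exists_eq_floor_add_of_mem_Ioo {x L : ℝ} {n : ℤ} (hn : (n : ℝ) ∈ Ioo x (x + L)) :
    ∃ i < Nat.floor L + 1, n = ⌊x⌋ + 1 + (i : ℤ) := by
  have h1 : ⌊x⌋ < n := Int.floor_lt.2 hn.1
  have h2 : n < ⌊x⌋ + 1 + ((Nat.floor L : ℤ) + 1) := by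
    have h3 := Int.lt_floor_add_one x
    have h4 := Nat.lt_floor_add_one L
    have h5 := hn.2
    have : (n : ℝ) < ((⌊x⌋ + 1 + ((Nat.floor L : ℤ) + 1) : ℤ) : ℝ) := by
      push_cast
      linarith
    exact_mod_cast this
  exact ⟨(n - ⌊x⌋ - 1).toNat, by omega, by omega⟩

theorem encard_intLattice_inter_shearAut_image_le {a : ℝ} (ha : 0 < a) (s ε : ℝ) :
    (intLattice ∩ shearAut a s '' ballInf ε).encard ≤
      (((Nat.floor (2 * ε * a) + 1) * (Nat.floor (2 * ε * Real.sqrt a) + 1) : ℕ) : ℕ∞) := by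
  have hr : 0 < Real.sqrt a := Real.sqrt_pos.2 ha
  let m : ℕ → ℤ := fun i => ⌊-(ε * a)⌋ + 1 + (i : ℤ)
  let n : ℕ → ℕ → ℤ := fun i j =>
    ⌊s * Real.sqrt a * ((m i : ℝ) / a) - ε * Real.sqrt a⌋ + 1 + (j : ℤ)
  let F : Finset (ℝ × ℝ) :=
    (Finset.range (Nat.floor (2 * ε * a) + 1) ×ˢ
      Finset.range (Nat.floor (2 * ε * Real.sqrt a) + 1)).image
      fun q => ((m q.1 : ℝ), (n q.1 q.2 : ℝ))
  have hF : F.card ≤ (Nat.floor (2 * ε * a) + 1) * (Nat.floor (2 * ε * Real.sqrt a) + 1) :=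
    Finset.card_image_le.trans (by simp)
  have hsub : intLattice ∩ shearAut a s '' ballInf ε ⊆ (F : Set (ℝ × ℝ)) := by
    rintro _ ⟨⟨k, l, rfl⟩, ⟨x, y⟩, ⟨hx, hy⟩, hxy⟩
    simp only [shearAut, Prod.mk.injEq] at hxy hx hy
    obtain ⟨hk, hl⟩ := hxy
    rw [abs_lt] at hx hy
    obtain ⟨i, hi, hki⟩ := exists_eq_floor_add_of_mem_Ioo (x := -(ε * a)) (L := 2 * ε * a) (n := k)
      ⟨by nlinarith, by nlinarith⟩
    have hxk : x = (k : ℝ) / a := by rw [← hk]; field_simp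
    obtain ⟨j, hj, hlj⟩ := exists_eq_floor_add_of_mem_Ioo
      (x := s * Real.sqrt a * ((k : ℝ) / a) - ε * Real.sqrt a) (L := 2 * ε * Real.sqrt a) (n := l)
      ⟨by rw [← hxk, ← hl]; nlinarith, by rw [← hxk, ← hl]; nlinarith⟩
    have hmk : m i = k := hki.symm
    refine Finset.mem_coe.2 (Finset.mem_image.2 ⟨(i, j), by simp [hi, hj], ?_⟩)
    simp only [n, hmk, ← hlj]
  calc (intLattice ∩ shearAut a s '' ballInf ε).encard ≤ (F : Set (ℝ × ℝ)).encard :=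
        encard_le_encard hsub
    _ = (F.card : ℕ∞) := encard_coe_eq_coe_finsetCard F
    _ ≤ _ := by exact_mod_cast hF

theorem zero_mem_intLattice_inter_shearAut_image (a s : ℝ) {ε : ℝ} (hε : 0 < ε) :
    (0 : ℝ × ℝ) ∈ intLattice ∩ shearAut a s '' ballInf ε :=
  ⟨⟨0, 0, by simp [Prod.ext_iff]⟩, 0, by simp [ballInf, hε], by simp [shearAut, Prod.ext_iff]⟩

theorem encard_intLattice_inter_shearAut_image_eq_one {a : ℝ} (ha : 0 < a) (ha1 : a < 1) (s : ℝ)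
    {ε : ℝ} (hε : 0 < ε) (hε' : ε < 1 / 2) :
    (intLattice ∩ shearAut a s '' ballInf ε).encard = 1 := by
  have hr1 : Real.sqrt a < 1 := by rw [Real.sqrt_lt' one_pos]; simpa using ha1
  have h1 : Nat.floor (2 * ε * a) = 0 := Nat.floor_eq_zero.2 (by nlinarith)
  have h2 : Nat.floor (2 * ε * Real.sqrt a) = 0 :=
    Nat.floor_eq_zero.2 (by nlinarith [Real.sqrt_nonneg a])
  refine le_antisymm ?_ (one_le_encard_iff_nonempty.2
    ⟨0, zero_mem_intLattice_inter_shearAut_image a s hε⟩)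
  simpa [h1, h2] using encard_intLattice_inter_shearAut_image_le ha s ε

theorem encard_intLattice_inter_shearAut_image_le_ofReal {a : ℝ} (ha : 1 ≤ a) (s : ℝ)
    {ε : ℝ} (hε : 0 < ε) :
    (intLattice ∩ shearAut a s '' ballInf ε).encard.toENNReal ≤
      ENNReal.ofReal (1 + 4 * ε * (ε + 1) * a ^ ((3 : ℝ) / 2)) := by
  have ha0 : 0 < a := one_pos.trans_le ha
  have hr : 1 ≤ Real.sqrt a := Real.one_le_sqrt.2 ha
  have hpow : a ^ ((3 : ℝ) / 2) = a * Real.sqrt a := by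
    rw [show (3 : ℝ) / 2 = 1 + 1 / 2 by norm_num, Real.rpow_add ha0, Real.rpow_one,
      Real.sqrt_eq_rpow]
  have hle := ENat.toENNReal_le.2 (encard_intLattice_inter_shearAut_image_le ha0 s ε)
  refine hle.trans ?_
  rw [ENat.toENNReal_coe, ← ENNReal.ofReal_natCast]
  apply ENNReal.ofReal_le_ofReal
  have h1 : (Nat.floor (2 * ε * a) : ℝ) ≤ 2 * ε * a := Nat.floor_le (by positivity)
  have h2 : (Nat.floor (2 * ε * Real.sqrt a) : ℝ) ≤ 2 * ε * Real.sqrt a :=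
    Nat.floor_le (by positivity)
  have h3 : a ≤ a * Real.sqrt a := le_mul_of_one_le_right ha0.le hr
  have h4 : Real.sqrt a ≤ a * Real.sqrt a := le_mul_of_one_le_left (by positivity) ha
  rw [hpow]
  push_cast
  calc ((Nat.floor (2 * ε * a) : ℝ) + 1) * ((Nat.floor (2 * ε * Real.sqrt a) : ℝ) + 1)
      ≤ (2 * ε * a + 1) * (2 * ε * Real.sqrt a + 1) := by gcongr
    _ = 1 + 2 * ε * a + 2 * ε * Real.sqrt a + 4 * ε * ε * (a * Real.sqrt a) := by ring
    _ ≤ 1 + 2 * ε * (a * Real.sqrt a) + 2 * ε * (a * Real.sqrt a)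
        + 4 * ε * ε * (a * Real.sqrt a) := by gcongr
    _ = 1 + 4 * ε * (ε + 1) * (a * Real.sqrt a) := by ring

/-- **Shearlet counting estimates (§4.3.3)**:
`♯(ℤ² ∩ αd_{a,s} B_∞(0,ε)) ≤ (⌊2εa⌋+1)(⌊2ε√a⌋+1)` for every `ε > 0`; for `0 < ε < 1/2`,
if `a < 1` the count equals `1`, and if `a ≥ 1` it is at most `1 + 4ε(ε+1)a^{3/2}`.
In particular the shearlet family has Property X with `δ(a,s) = a^{3/2}`. -/
theorem shearlet_propertyX :
    (∀ a : ℝ, 0 < a → ∀ s : ℝ, ∀ ε : ℝ, 0 < ε →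
      (intLattice ∩ shearAut a s '' ballInf ε).encard ≤
        (((Nat.floor (2 * ε * a) + 1) * (Nat.floor (2 * ε * Real.sqrt a) + 1) : ℕ) : ℕ∞)) ∧
    (∀ a : ℝ, 0 < a → ∀ s : ℝ, ∀ ε : ℝ, 0 < ε → ε < 1 / 2 →
      (a < 1 → (intLattice ∩ shearAut a s '' ballInf ε).encard = 1) ∧
      (1 ≤ a → (intLattice ∩ shearAut a s '' ballInf ε).encard.toENNReal ≤
        ENNReal.ofReal (1 + 4 * ε * (ε + 1) * a ^ ((3 : ℝ) / 2)))) ∧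
    (∃ r > (0 : ℝ), ∃ C > (0 : ℝ), ∀ a : ℝ, 0 < a → ∀ s : ℝ,
      (intLattice ∩ shearAut a s '' ballInf r).encard.toENNReal ≤
        1 + ENNReal.ofReal (C * a ^ ((3 : ℝ) / 2))) := by
  refine ⟨fun a ha s ε _ => encard_intLattice_inter_shearAut_image_le ha s ε,
    fun a ha s ε hε hε' =>
      ⟨fun ha1 => encard_intLattice_inter_shearAut_image_eq_one ha ha1 s hε hε',
        fun ha1 => encard_intLattice_inter_shearAut_image_le_ofReal ha1 s hε⟩,
    1 / 4, by norm_num, 4 * (1 / 4) * (1 / 4 + 1), by norm_num, fun a ha s => ?_⟩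
  rcases lt_or_ge a 1 with ha1 | ha1
  · rw [encard_intLattice_inter_shearAut_image_eq_one ha ha1 s (by norm_num) (by norm_num)]
    simp
  · refine (encard_intLattice_inter_shearAut_image_le_ofReal ha1 s (by norm_num)).trans ?_
    rw [ENNReal.ofReal_add zero_le_one (by positivity), ENNReal.ofReal_one]
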